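/- arXiv:2012.15851 — 2 statements merged into one kernel-verified Lean document; each statement's English description precedes it below -/
import Mathlib

section
/- Let k ≥ 1 be a real number, let 0 < η ≤ 1, and let A and B be nonnegative real random variables on a probability space such that A^k, B^k and (A+B)^k are integrable. If E[A^k] ≤ η·E[B^k], then E[(A+B)^k] ≤ (1 + k·2^k·η^{1/k})·E[B^k]. -/
open MeasureTheory

theorem stmt_2 {Ω : Type*} [MeasurableSpace Ω] (ℙ : Measure Ω) [IsProbabilityMeasure ℙ]
    (k : ℝ) (hk : 1 ≤ k) (η : ℝ) (hη0 : 0 < η) (hη1 : η ≤ 1) (A B : Ω → ℝ)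
    (hA : Measurable A) (hB : Measurable B)
    (hA0 : ∀ ω, 0 ≤ A ω) (hB0 : ∀ ω, 0 ≤ B ω)
    (hAk : Integrable (fun ω => A ω ^ k) ℙ)
    (hBk : Integrable (fun ω => B ω ^ k) ℙ)
    (hABk : Integrable (fun ω => (A ω + B ω) ^ k) ℙ)
    (h : ∫ ω, A ω ^ k ∂ℙ ≤ η * ∫ ω, B ω ^ k ∂ℙ) :
    ∫ ω, (A ω + B ω) ^ k ∂ℙ ≤
      (1 + k * (2 : ℝ) ^ k * η ^ (1 / k)) * ∫ ω, B ω ^ k ∂ℙ := by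
  have hk0 : 0 < k := by linarith
  obtain ⟨t, ht⟩ : ∃ t, t = η ^ (1 / k) := ⟨_, rfl⟩
  have ht0 : 0 < t := ht ▸ Real.rpow_pos_of_pos hη0 _
  have ht1 : t ≤ 1 := ht ▸ Real.rpow_le_one hη0.le hη1 (by positivity)
  have htk : t ^ k = η := by
    rw [ht, ← Real.rpow_mul hη0.le, one_div, inv_mul_cancel₀ hk0.ne', Real.rpow_one]
  rw [← ht]
  have hI : 0 ≤ ∫ ω, B ω ^ k ∂ℙ := integral_nonneg fun ω => Real.rpow_nonneg (hB0 ω) _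
  have hconv : ∀ x y a b : ℝ, 0 ≤ x → 0 ≤ y → 0 ≤ a → 0 ≤ b → a + b = 1 →
      (a * x + b * y) ^ k ≤ a * x ^ k + b * y ^ k :=
    fun x y a b hx hy ha hb hab => (convexOn_rpow hk).2 hx hy ha hb hab
  -- the pointwise bound from convexity
  have hpt : ∀ a b : ℝ, 0 ≤ a → 0 ≤ b →
      (a + b) ^ k ≤ (1 + t) ^ k / (1 + t) * (b ^ k + t / η * a ^ k) := by
    intro a b ha hb
    have hat : 0 ≤ a / t := by positivity
    have h1 := hconv b (a / t) (1 / (1 + t)) (t / (1 + t)) hb hat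
      (by positivity) (by positivity) (by field_simp)
    have e1 : 1 / (1 + t) * b + t / (1 + t) * (a / t) = (a + b) / (1 + t) := by
      field_simp; ring
    rw [e1, Real.div_rpow (by positivity) (by positivity), Real.div_rpow ha ht0.le, htk,
      div_le_iff₀ (by positivity)] at h1
    refine h1.trans (le_of_eq ?_)
    field_simp
  have h2 : (1 + t) ^ k ≤ 1 + k * (2 : ℝ) ^ k * t := by
    have h1 := hconv 1 2 (1 - t) t (by simp) (by simp)
      (by linarith) ht0.le (by ring)
    simp only [Real.one_rpow] at h1
    have e1 : (1 - t) * 1 + t * 2 = 1 + t := by ring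
    rw [e1] at h1
    have hp : (0 : ℝ) < 2 ^ k := by positivity
    nlinarith [mul_nonneg (mul_nonneg (sub_nonneg.2 hk) hp.le) ht0.le]
  calc ∫ ω, (A ω + B ω) ^ k ∂ℙ
      ≤ ∫ ω, (1 + t) ^ k / (1 + t) * (B ω ^ k + t / η * A ω ^ k) ∂ℙ :=
        integral_mono hABk ((hBk.add (hAk.const_mul _)).const_mul _)
          fun ω => hpt _ _ (hA0 ω) (hB0 ω)
    _ = (1 + t) ^ k / (1 + t) * (∫ ω, B ω ^ k ∂ℙ + t / η * ∫ ω, A ω ^ k ∂ℙ) := by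
        rw [integral_const_mul, integral_add hBk (hAk.const_mul _), integral_const_mul]
    _ ≤ (1 + t) ^ k / (1 + t) * (∫ ω, B ω ^ k ∂ℙ + t / η * (η * ∫ ω, B ω ^ k ∂ℙ)) := by
        gcongr
    _ = (1 + t) ^ k * ∫ ω, B ω ^ k ∂ℙ := by
        field_simp
    _ ≤ _ := mul_le_mul_of_nonneg_right h2 hI
end

section
/- Let k ≥ 1 be a real number and let A and B be nonnegative real random variables on a probability space such that A^k, B^k and (A+B)^k are integrable. Then E[(A+B)^k] ≤ E[B^k] + k·2^{k-1}·( E[A^k] + E[A^k]^{1/k} · E[B^k]^{(k-1)/k} ). -/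
open MeasureTheory

lemma aux_pointwise (k : ℝ) (hk : 1 ≤ k) (a b : ℝ) (ha : 0 ≤ a) (hb : 0 ≤ b) :
    (a + b) ^ k ≤ b ^ k + k * (2 : ℝ) ^ (k - 1) * (a ^ k + a * b ^ (k - 1)) := by
  have hk0 : 0 < k := by linarith
  rcases eq_or_lt_of_le ha with h0 | ha'
  · subst h0
    simp [Real.zero_rpow hk0.ne']
  have hs : 0 < a + b := by linarith
  have hak : a ^ k = a * a ^ (k - 1) := by
    rw [Real.rpow_sub_one ha'.ne']; field_simp
  have hsk : (a + b) ^ k = (a + b) * (a + b) ^ (k - 1) := by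
    rw [Real.rpow_sub_one hs.ne']; field_simp
  have h1 : (a + b) ^ k - k * a * (a + b) ^ (k - 1) ≤ b ^ k := by
    have hle : a / (a + b) ≤ 1 := by rw [div_le_one hs]; linarith
    have hB := one_add_mul_self_le_rpow_one_add (s := -(a / (a + b))) (by linarith) hk
    have e : 1 + -(a / (a + b)) = b / (a + b) := by field_simp; ring
    rw [e, Real.div_rpow hb hs.le] at hB
    have hp : 0 < (a + b) ^ k := Real.rpow_pos_of_pos hs k
    rw [le_div_iff₀ hp] at hB
    refine le_trans (le_of_eq ?_) hB
    rw [hsk]; field_simp; ring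
  have h2 : (a + b) ^ (k - 1) ≤ 2 ^ (k - 1) * (a ^ (k - 1) + b ^ (k - 1)) := by
    have pa : 0 ≤ a ^ (k - 1) := Real.rpow_nonneg ha _
    have pb : 0 ≤ b ^ (k - 1) := Real.rpow_nonneg hb _
    have p2 : (0:ℝ) ≤ 2 ^ (k - 1) := by positivity
    rcases le_total a b with h | h
    · calc (a + b) ^ (k - 1) ≤ (2 * b) ^ (k - 1) :=
            Real.rpow_le_rpow hs.le (by linarith) (by linarith)
        _ = 2 ^ (k - 1) * b ^ (k - 1) := Real.mul_rpow (by norm_num) hb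
        _ ≤ _ := mul_le_mul_of_nonneg_left (by linarith) p2
    · calc (a + b) ^ (k - 1) ≤ (2 * a) ^ (k - 1) :=
            Real.rpow_le_rpow hs.le (by linarith) (by linarith)
        _ = 2 ^ (k - 1) * a ^ (k - 1) := Real.mul_rpow (by norm_num) ha
        _ ≤ _ := mul_le_mul_of_nonneg_left (by linarith) p2
  have h3 := mul_le_mul_of_nonneg_left h2 (by positivity : 0 ≤ k * a)
  rw [hak]
  linarith

lemma aux_memLp {Ω : Type*} [MeasurableSpace Ω] (μ : Measure Ω) (p : ℝ) (hp : 0 < p)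
    (f : Ω → ℝ) (hf : Measurable f) (hf0 : ∀ ω, 0 ≤ f ω)
    (hi : Integrable (fun ω => f ω ^ p) μ) : MemLp f (ENNReal.ofReal p) μ := by
  rw [← integrable_norm_rpow_iff hf.aestronglyMeasurable (by simpa using hp) (by simp)]
  simpa [ENNReal.toReal_ofReal hp.le, abs_of_nonneg (hf0 _)] using hi

lemma aux_holder {Ω : Type*} [MeasurableSpace Ω] (ℙ : Measure Ω)
    (k : ℝ) (hk : 1 ≤ k) (A B : Ω → ℝ)
    (hA : Measurable A) (hB : Measurable B)
    (hA0 : ∀ ω, 0 ≤ A ω) (hB0 : ∀ ω, 0 ≤ B ω)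
    (hAk : Integrable (fun ω => A ω ^ k) ℙ)
    (hBk : Integrable (fun ω => B ω ^ k) ℙ) :
    Integrable (fun ω => A ω * B ω ^ (k - 1)) ℙ ∧
    ∫ ω, A ω * B ω ^ (k - 1) ∂ℙ ≤
      (∫ ω, A ω ^ k ∂ℙ) ^ (1 / k) * (∫ ω, B ω ^ k ∂ℙ) ^ ((k - 1) / k) := by
  rcases eq_or_lt_of_le hk with h | h
  · subst h
    simp at hAk ⊢
    exact hAk
  have hk0 : 0 < k := by linarith
  have hk1 : 0 < k - 1 := by linarith
  have hpq : k.HolderConjugate (k / (k - 1)) := Real.HolderConjugate.conjExponent h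
  have e : ∀ ω, (B ω ^ (k - 1)) ^ (k / (k - 1)) = B ω ^ k := fun ω => by
    rw [← Real.rpow_mul (hB0 ω)]; congr 1; field_simp
  have hC0 : ∀ ω, 0 ≤ B ω ^ (k - 1) := fun ω => Real.rpow_nonneg (hB0 ω) _
  have mA := aux_memLp ℙ k hk0 A hA hA0 hAk
  have mB := aux_memLp ℙ (k / (k - 1)) (by positivity) (fun ω => B ω ^ (k - 1))
    (hB.pow_const _) hC0 (by simpa only [e] using hBk)
  have : ENNReal.HolderConjugate (ENNReal.ofReal k) (ENNReal.ofReal (k / (k - 1))) :=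
    hpq.ennrealOfReal
  refine ⟨MemLp.integrable_mul mA mB, ?_⟩
  have H := integral_mul_le_Lp_mul_Lq_of_nonneg hpq (Filter.Eventually.of_forall hA0)
    (Filter.Eventually.of_forall hC0) mA mB
  simpa only [e, one_div_div] using H


theorem stmt_3 {Ω : Type*} [MeasurableSpace Ω] (ℙ : Measure Ω) [IsProbabilityMeasure ℙ]
    (k : ℝ) (hk : 1 ≤ k) (A B : Ω → ℝ)
    (hA : Measurable A) (hB : Measurable B)
    (hA0 : ∀ ω, 0 ≤ A ω) (hB0 : ∀ ω, 0 ≤ B ω)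
    (hAk : Integrable (fun ω => A ω ^ k) ℙ)
    (hBk : Integrable (fun ω => B ω ^ k) ℙ)
    (hABk : Integrable (fun ω => (A ω + B ω) ^ k) ℙ) :
    ∫ ω, (A ω + B ω) ^ k ∂ℙ ≤
      (∫ ω, B ω ^ k ∂ℙ) +
        k * (2 : ℝ) ^ (k - 1) *
          ((∫ ω, A ω ^ k ∂ℙ) +
            (∫ ω, A ω ^ k ∂ℙ) ^ (1 / k) * (∫ ω, B ω ^ k ∂ℙ) ^ ((k - 1) / k)) := by
  obtain ⟨hI, hH⟩ := aux_holder ℙ k hk A B hA hB hA0 hB0 hAk hBk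
  have hc : 0 ≤ k * (2 : ℝ) ^ (k - 1) := by positivity
  calc ∫ ω, (A ω + B ω) ^ k ∂ℙ
      ≤ ∫ ω, (B ω ^ k + k * (2 : ℝ) ^ (k - 1) * (A ω ^ k + A ω * B ω ^ (k - 1))) ∂ℙ :=
        integral_mono hABk (hBk.add ((hAk.add hI).const_mul _))
          (fun ω => aux_pointwise k hk _ _ (hA0 ω) (hB0 ω))
    _ = (∫ ω, B ω ^ k ∂ℙ) + k * (2 : ℝ) ^ (k - 1) *
          ((∫ ω, A ω ^ k ∂ℙ) + ∫ ω, A ω * B ω ^ (k - 1) ∂ℙ) := by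
        have hJ : Integrable
            (fun ω => k * (2 : ℝ) ^ (k - 1) * (A ω ^ k + A ω * B ω ^ (k - 1))) ℙ :=
          (hAk.add hI).const_mul _
        rw [integral_add hBk hJ, integral_const_mul,
          integral_add hAk hI]
    _ ≤ _ := by gcongr
end
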